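/- If a temporal interaction network is a chain, then the greedy assignment delivers the maximum possible flow to the sink at every time moment: for every θ ∈ ℝ and every flow assignment x, Σ{x(i) : dest(i) = t, τ(i) ≤ θ} ≤ Σ{g(i) : dest(i) = t, τ(i) ≤ θ}. -/

import Mathlib

noncomputable section
attribute [local instance] Classical.propDecidable

/-- A temporal interaction network over an ambient vertex type `ν` and an
ambient interaction-index type `ι`: a finite vertex set `V`, a finite
interaction set `I`, a distinguished source `s` and sink `t`, and, for each
interaction, a source vertex, a destination vertex, a timestamp and a
quantity. -/
structure TIN (ν ι : Type) where
  V : Finset ν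
  I : Finset ι
  s : ν
  t : ν
  src : ι → ν
  dest : ι → ν
  τ : ι → ℝ
  q : ι → ℝ

namespace TIN

variable {ν ι : Type}

/-- The axioms of a temporal interaction network: `s,t ∈ V` are distinct, every
interaction joins two distinct vertices of `V`, quantities are nonnegative,
distinct interactions have distinct timestamps, no interaction enters `s`
and no interaction leaves `t`. -/
def Valid (N : TIN ν ι) : Prop :=
  N.s ∈ N.V ∧ N.t ∈ N.V ∧ N.s ≠ N.t ∧
  (∀ i ∈ N.I, N.src i ∈ N.V ∧ N.dest i ∈ N.V ∧ N.dest i ≠ N.src i ∧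
      0 ≤ N.q i ∧ N.dest i ≠ N.s ∧ N.src i ≠ N.t) ∧
  (∀ i ∈ N.I, ∀ j ∈ N.I, N.τ i = N.τ j → i = j)

/-- A flow assignment: (i) `0 ≤ x i ≤ q i`; (ii) `x i = q i` when `src i = s`;
(iii) for `src i ≠ s`, `x i` is at most the quantity received by `src i`
strictly before time `τ i` minus the quantity sent by `src i` strictly
before time `τ i`. -/
def IsFlow (N : TIN ν ι) (x : ι → ℝ) : Prop :=
  (∀ i ∈ N.I, 0 ≤ x i ∧ x i ≤ N.q i) ∧
  (∀ i ∈ N.I, N.src i = N.s → x i = N.q i) ∧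
  (∀ i ∈ N.I, N.src i ≠ N.s →
    x i ≤ (∑ j ∈ N.I.filter fun j => N.dest j = N.src i ∧ N.τ j < N.τ i, x j)
        - (∑ j ∈ N.I.filter fun j => N.src j = N.src i ∧ N.τ j < N.τ i, x j))

/-- The value of an assignment: the total quantity arriving at the sink. -/
def val (N : TIN ν ι) (x : ι → ℝ) : ℝ :=
  ∑ i ∈ N.I.filter fun i => N.dest i = N.t, x i

/-- The maximum flow: the supremum of the values of all flow assignments. -/
def maxFlow (N : TIN ν ι) : ℝ :=
  sSup {r : ℝ | ∃ x, N.IsFlow x ∧ N.val x = r}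

/-- One step of the greedy algorithm: the state consists of the assignment
built so far and the buffers; processing interaction `i` transfers the
maximal possible amount from the buffer of `src i` to the buffer of
`dest i` (the source `s` having unlimited supply). -/
def greedyStep (N : TIN ν ι) (gB : (ι → ℝ) × (ν → ℝ)) (i : ι) : (ι → ℝ) × (ν → ℝ) :=
  let amt : ℝ := if N.src i = N.s then N.q i else min (N.q i) (gB.2 (N.src i))
  (Function.update gB.1 i amt,
   fun v => gB.2 v + (if v = N.dest i then amt else 0)
          - (if v = N.src i ∧ N.src i ≠ N.s then amt else 0))

/-- The interactions listed in increasing order of timestamp. -/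
def sortedI (N : TIN ν ι) : List ι :=
  N.I.toList.mergeSort fun a b => decide (N.τ a ≤ N.τ b)

/-- The greedy assignment: process the interactions in increasing order of
timestamp, starting with all buffers at `0`. -/
def greedy (N : TIN ν ι) : ι → ℝ :=
  (N.sortedI.foldl N.greedyStep (fun _ => 0, fun _ => 0)).1

end TIN

/-- The network is a chain: `V = {v 0, …, v k}` with `k ≥ 1`, `v 0 = s`,
`v k = t`, the vertices `v 0, …, v k` pairwise distinct, and every interaction
goes from some `v j` to `v (j+1)` with `j < k`. -/
def TIN.IsChainNet {ν ι : Type} (N : TIN ν ι) : Prop :=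
  ∃ k : ℕ, 1 ≤ k ∧ ∃ v : ℕ → ν,
    (∀ a ≤ k, ∀ b ≤ k, v a = v b → a = b) ∧
    v 0 = N.s ∧ v k = N.t ∧
    (∀ j ≤ k, v j ∈ N.V) ∧ (∀ w ∈ N.V, ∃ j ≤ k, v j = w) ∧
    ∀ i ∈ N.I, ∃ j < k, N.src i = v j ∧ N.dest i = v (j + 1)

namespace TIN

variable {ν ι : Type} (N : TIN ν ι)

theorem foldl_greedyStep_fst_of_notMem {l : List ι} {j : ι} (hj : j ∉ l)
    (gB : (ι → ℝ) × (ν → ℝ)) : (l.foldl N.greedyStep gB).1 j = gB.1 j := by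
  induction l generalizing gB with
  | nil => rfl
  | cons a l ih =>
    rw [List.mem_cons, not_or] at hj
    rw [List.foldl_cons, ih hj.2]
    simp [greedyStep, Function.update_of_ne hj.1]

/-- During the greedy run, the buffer of a vertex other than the source is its inflow minus
its outflow. -/
theorem foldl_greedyStep_snd {l : List ι} (hl : l.Nodup) {v : ν} (hv : v ≠ N.s) :
    (l.foldl N.greedyStep (fun _ => 0, fun _ => 0)).2 v =
      (∑ j ∈ l.toFinset.filter fun j => N.dest j = v,
          (l.foldl N.greedyStep (fun _ => 0, fun _ => 0)).1 j)
        - (∑ j ∈ l.toFinset.filter fun j => N.src j = v,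
          (l.foldl N.greedyStep (fun _ => 0, fun _ => 0)).1 j) := by
  induction l using List.reverseRecOn with
  | nil => simp
  | append_singleton l a ih =>
    rw [← List.concat_eq_append, List.nodup_concat] at hl
    specialize ih hl.2
    have ha : a ∉ l.toFinset := by simpa using hl.1
    have hins : (l ++ [a]).toFinset = insert a l.toFinset := by ext; simp
    rw [List.foldl_append, hins]
    set gB := l.foldl N.greedyStep (fun _ => 0, fun _ => 0) with hgB
    have hold : ∀ j ∈ l.toFinset, (N.greedyStep gB a).1 j = gB.1 j := fun j hj =>
      Function.update_of_ne (ne_of_mem_of_not_mem hj ha) _ _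
    have hsum : ∀ p : ι → Prop,
        (∑ j ∈ (insert a l.toFinset).filter p, (N.greedyStep gB a).1 j) =
          (if p a then (N.greedyStep gB a).1 a else 0) + ∑ j ∈ l.toFinset.filter p, gB.1 j := by
      intro p
      rw [Finset.sum_filter, Finset.sum_insert ha, Finset.sum_filter]
      congr 1
      exact Finset.sum_congr rfl fun j hj => by rw [hold j hj]
    simp only [List.foldl_cons, List.foldl_nil]
    rw [hsum, hsum]
    have hstep : (N.greedyStep gB a).2 v = gB.2 v
        + (if v = N.dest a then (N.greedyStep gB a).1 a else 0)
        - (if v = N.src a ∧ N.src a ≠ N.s then (N.greedyStep gB a).1 a else 0) := by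
      simp [greedyStep]
    have hsrc : (v = N.src a ∧ N.src a ≠ N.s) ↔ N.src a = v :=
      ⟨fun h => h.1.symm, fun h => ⟨h.symm, h ▸ hv⟩⟩
    have hdest : v = N.dest a ↔ N.dest a = v := eq_comm
    rw [hstep, ih]
    simp only [hsrc, hdest]
    ring

theorem mem_sortedI {i : ι} : i ∈ N.sortedI ↔ i ∈ N.I := by
  simp [sortedI]

theorem nodup_sortedI : N.sortedI.Nodup :=
  (List.mergeSort_perm _ _).nodup_iff.2 N.I.nodup_toList

theorem pairwise_sortedI : N.sortedI.Pairwise fun a b => N.τ a ≤ N.τ b := by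
  have h := List.pairwise_mergeSort (le := fun a b => decide (N.τ a ≤ N.τ b))
    (fun a b c hab hbc => by simp only [decide_eq_true_eq] at *; exact hab.trans hbc)
    (fun a b => by simpa using le_total (N.τ a) (N.τ b)) N.I.toList
  simpa [sortedI] using h

/-- The greedy assignment satisfies the recursion defining it, in terms of inflows and
outflows before the current time. -/
theorem greedy_eq (hτ : ∀ i ∈ N.I, ∀ j ∈ N.I, N.τ i = N.τ j → i = j) {i : ι} (hi : i ∈ N.I) :
    N.greedy i = if N.src i = N.s then N.q i else min (N.q i)
      ((∑ j ∈ N.I.filter fun j => N.dest j = N.src i ∧ N.τ j < N.τ i, N.greedy j)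
        - (∑ j ∈ N.I.filter fun j => N.src j = N.src i ∧ N.τ j < N.τ i, N.greedy j)) := by
  obtain ⟨l, r, hlr⟩ := List.append_of_mem (N.mem_sortedI.2 hi)
  have hnd := N.nodup_sortedI
  have hpw := N.pairwise_sortedI
  rw [hlr, List.nodup_append] at hnd
  rw [hlr, List.pairwise_append] at hpw
  obtain ⟨hl, hir, hdisj⟩ := hnd
  obtain ⟨-, hpr, hle⟩ := hpw
  rw [List.nodup_cons] at hir
  rw [List.pairwise_cons] at hpr
  have hmem : ∀ j, j ∈ N.I ↔ j ∈ l ∨ j = i ∨ j ∈ r := fun j => by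
    rw [← mem_sortedI, hlr]; simp
  have hbefore : ∀ j, j ∈ l ↔ j ∈ N.I ∧ N.τ j < N.τ i := by
    intro j
    constructor
    · intro hj
      have hjI := (hmem j).2 (Or.inl hj)
      exact ⟨hjI, lt_of_le_of_ne (hle j hj i (by simp))
        fun h => hdisj j hj i (by simp) (hτ j hjI i hi h)⟩
    · rintro ⟨hj, hlt⟩
      rcases (hmem j).1 hj with h | rfl | h
      · exact h
      · exact absurd hlt (lt_irrefl _)
      · exact absurd hlt (not_lt.2 (hpr.1 j h))
  have hpartial : ∀ j ∈ l,
      (l.foldl N.greedyStep (fun _ => 0, fun _ => 0)).1 j = N.greedy j := by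
    intro j hj
    rw [greedy, hlr, List.foldl_append]
    exact (N.foldl_greedyStep_fst_of_notMem (fun h => hdisj j hj j h rfl) _).symm
  have hsum : ∀ p : ι → Prop,
      (∑ j ∈ l.toFinset.filter p, (l.foldl N.greedyStep (fun _ => 0, fun _ => 0)).1 j) =
        ∑ j ∈ N.I.filter fun j => p j ∧ N.τ j < N.τ i, N.greedy j := by
    intro p
    refine Finset.sum_congr ?_ fun j hj => hpartial j ?_
    · ext j
      simp only [Finset.mem_filter, List.mem_toFinset, hbefore]
      tauto
    · exact (hbefore j).2 ⟨(Finset.mem_filter.1 hj).1, (Finset.mem_filter.1 hj).2.2⟩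
  have hgi : N.greedy i = (N.greedyStep (l.foldl N.greedyStep (fun _ => 0, fun _ => 0)) i).1 i := by
    rw [greedy, hlr, List.foldl_append, List.foldl_cons, foldl_greedyStep_fst_of_notMem _ hir.1]
  rw [hgi]
  simp only [greedyStep, Function.update_self]
  split_ifs with hs
  · rfl
  · rw [N.foldl_greedyStep_snd hl hs, hsum, hsum]

/-- If interactions with a common source vertex are exactly those with a common destination,
then up to any moment every vertex receives under the greedy assignment at least as much as
under any other flow assignment. -/
theorem inflow_le_greedy (hτ : ∀ i ∈ N.I, ∀ j ∈ N.I, N.τ i = N.τ j → i = j)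
    (hsd : ∀ i ∈ N.I, ∀ j ∈ N.I, N.src j = N.src i ↔ N.dest j = N.dest i)
    {x : ι → ℝ} (hx : N.IsFlow x) (S : Finset ι) (hS : S ⊆ N.I)
    (hlow : ∀ a ∈ S, ∀ b ∈ N.I, N.τ b ≤ N.τ a → b ∈ S) (w : ν) :
    (∑ i ∈ S.filter fun i => N.dest i = w, x i) ≤
      ∑ i ∈ S.filter fun i => N.dest i = w, N.greedy i := by
  induction S using Finset.induction_on_max_value N.τ generalizing w with
  | empty => simp
  | insert a S ha hmax ih =>
    rw [Finset.insert_subset_iff] at hS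
    obtain ⟨haI, hSI⟩ := hS
    have hlt : ∀ j ∈ S, N.τ j < N.τ a := fun j hj =>
      lt_of_le_of_ne (hmax j hj) fun h => ha (hτ j (hSI hj) a haI h ▸ hj)
    have hSmem : ∀ j, j ∈ S ↔ j ∈ N.I ∧ N.τ j < N.τ a := by
      refine fun j => ⟨fun hj => ⟨hSI hj, hlt j hj⟩, fun ⟨hj, hja⟩ => ?_⟩
      refine (Finset.mem_insert.1 (hlow a (Finset.mem_insert_self a S) j hj hja.le)).resolve_left ?_
      rintro rfl
      exact lt_irrefl _ hja
    have ih' := ih hSI fun c hc b hb hbc =>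
      (hSmem b).2 ⟨hb, hbc.trans_lt (hlt c hc)⟩
    rw [Finset.filter_insert]
    split_ifs with hw
    swap
    · exact ih' w
    have hna : a ∉ S.filter fun i => N.dest i = w := fun h => ha (Finset.mem_filter.1 h).1
    rw [Finset.sum_insert hna, Finset.sum_insert hna]
    have hin : (N.I.filter fun j => N.dest j = N.src a ∧ N.τ j < N.τ a) =
        S.filter fun j => N.dest j = N.src a := by
      ext j
      simp only [Finset.mem_filter, hSmem]
      tauto
    have hout : (N.I.filter fun j => N.src j = N.src a ∧ N.τ j < N.τ a) =
        S.filter fun j => N.dest j = w := by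
      ext j
      simp only [Finset.mem_filter, hSmem]
      constructor
      · rintro ⟨hj, h, hja⟩
        exact ⟨⟨hj, hja⟩, ((hsd a haI j hj).1 h).trans hw⟩
      · rintro ⟨⟨hj, hja⟩, h⟩
        exact ⟨hj, (hsd a haI j hj).2 (h.trans hw.symm), hja⟩
    have hg := N.greedy_eq hτ haI
    rw [hin, hout] at hg
    have hxq := (hx.1 a haI).2
    have hIw := ih' w
    split_ifs at hg with hs
    · linarith
    · have hxa := hx.2.2 a haI hs
      rw [hin, hout] at hxa
      have hIsrc := ih' (N.src a)
      rcases min_choice (N.q a) ((∑ j ∈ S.filter fun j => N.dest j = N.src a, N.greedy j)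
        - ∑ j ∈ S.filter fun j => N.dest j = w, N.greedy j) with h | h <;>
      · rw [h] at hg
        linarith

theorem IsChainNet.src_eq_iff_dest_eq {N : TIN ν ι} (h : N.IsChainNet) :
    ∀ i ∈ N.I, ∀ j ∈ N.I, N.src j = N.src i ↔ N.dest j = N.dest i := by
  obtain ⟨k, -, v, hinj, -, -, -, -, hI⟩ := h
  intro i hi j hj
  obtain ⟨a, ha, hsa, hda⟩ := hI i hi
  obtain ⟨b, hb, hsb, hdb⟩ := hI j hj
  rw [hsa, hda, hsb, hdb]
  constructor
  · intro h
    rw [hinj b hb.le a ha.le h]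
  · intro h
    rw [Nat.succ_injective (hinj (b + 1) hb (a + 1) ha h)]

end TIN

/-- On a chain, the greedy assignment delivers the maximum
possible flow to the sink at every time moment. -/
theorem greedy_cumulative_optimal_of_chain (ν ι : Type) (N : TIN ν ι) (hN : N.Valid)
    (hchain : N.IsChainNet) :
    ∀ θ : ℝ, ∀ x : ι → ℝ, N.IsFlow x →
      (∑ i ∈ N.I.filter fun i => N.dest i = N.t ∧ N.τ i ≤ θ, x i) ≤
      (∑ i ∈ N.I.filter fun i => N.dest i = N.t ∧ N.τ i ≤ θ, N.greedy i) := by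
  intro θ x hx
  have hfilter : (N.I.filter fun i => N.dest i = N.t ∧ N.τ i ≤ θ) =
      (N.I.filter fun i => N.τ i ≤ θ).filter fun i => N.dest i = N.t := by
    ext i
    simp only [Finset.mem_filter]
    tauto
  rw [hfilter]
  refine N.inflow_le_greedy hN.2.2.2.2 hchain.src_eq_iff_dest_eq hx _
    (Finset.filter_subset _ _) (fun a ha b hb hba => ?_) N.t
  exact Finset.mem_filter.2 ⟨hb, hba.trans (Finset.mem_filter.1 ha).2⟩
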